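/- The map γ : [0,1) → ℝ × [0,1] defined by γ(t) = (tan(πt/2), t) is an injective continuous proper map, hence a closed embedding; its image P = {(tan(πt/2), t) : t ∈ [0,1)} is a closed subset of ℝ × [0,1] that intersects ℝ × {0} exactly in the single point (0,0) and is disjoint from ℝ × {1}. (This is the curve exhibiting that a point in a line is proper null-cobordant.) -/

import Mathlib

open Real Set

theorem pi_mul_div_two_mem_Ioo (t : Ico (0 : ℝ) 1) :
    π * (t : ℝ) / 2 ∈ Ioo (-(π / 2)) (π / 2) := by
  obtain ⟨t, h0, h1⟩ := t
  constructor <;> nlinarith [pi_pos]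

theorem continuous_tan_pi_mul_div_two :
    Continuous fun t : Ico (0 : ℝ) 1 => Real.tan (π * (t : ℝ) / 2) :=
  continuousOn_tan_Ioo.comp_continuous (by fun_prop) pi_mul_div_two_mem_Ioo

/-- The map `x ↦ max 0 (2 / π * arctan x)`, a continuous left inverse on `[0,1)` of
`t ↦ tan (π * t / 2)`. -/
noncomputable def arctanIco (x : ℝ) : Ico (0 : ℝ) 1 :=
  ⟨max 0 (2 / π * arctan x), le_max_left _ _, max_lt one_pos (by
    rw [div_mul_eq_mul_div, div_lt_one pi_pos]
    linarith [arctan_lt_pi_div_two x])⟩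

theorem continuous_arctanIco : Continuous arctanIco :=
  Continuous.subtype_mk (by fun_prop) _

theorem arctanIco_tan (t : Ico (0 : ℝ) 1) : arctanIco (Real.tan (π * (t : ℝ) / 2)) = t := by
  obtain ⟨h1, h2⟩ := pi_mul_div_two_mem_Ioo t
  have h : 2 / π * (π * (t : ℝ) / 2) = t := by field_simp
  apply Subtype.ext
  simp only [arctanIco, arctan_tan h1 h2, h, max_eq_right t.2.1]

/-- **The curve exhibiting that a point in a line is proper null-cobordant.**
The map `γ : [0,1) → ℝ × [0,1]`, `γ(t) = (tan(πt/2), t)`, is an injective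
continuous proper map, hence a closed embedding; its image
`P = {(tan(πt/2), t) : t ∈ [0,1)}` is closed in `ℝ × [0,1]`, meets
`ℝ × {0}` exactly in the single point `(0,0)`, and is disjoint from `ℝ × {1}`. -/
theorem tan_curve_proper_nullcobordism :
    letI γ : Ico (0 : ℝ) 1 → ℝ × Icc (0 : ℝ) 1 :=
      fun t => (Real.tan (π * (t : ℝ) / 2), ⟨(t : ℝ), ⟨t.2.1, t.2.2.le⟩⟩)
    Continuous γ ∧ Function.Injective γ ∧ IsProperMap γ ∧ Topology.IsClosedEmbedding γ ∧
      IsClosed (Set.range γ) ∧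
      (Set.range γ ∩ {p : ℝ × Icc (0 : ℝ) 1 | (p.2 : ℝ) = 0} =
        {((0 : ℝ), (⟨0, Set.left_mem_Icc.mpr zero_le_one⟩ : Icc (0 : ℝ) 1))}) ∧
      (∀ p ∈ Set.range γ, ((p.2 : ℝ) ≠ 1)) := by
  let γ : Ico (0 : ℝ) 1 → ℝ × Icc (0 : ℝ) 1 :=
    fun t => (Real.tan (π * (t : ℝ) / 2), ⟨(t : ℝ), ⟨t.2.1, t.2.2.le⟩⟩)
  have hc : Continuous γ :=
    continuous_tan_pi_mul_div_two.prodMk (continuous_subtype_val.subtype_mk _)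
  have hinv : Function.LeftInverse (fun p : ℝ × Icc (0 : ℝ) 1 => arctanIco p.1) γ :=
    arctanIco_tan
  have he : Topology.IsClosedEmbedding γ :=
    hinv.isClosedEmbedding (continuous_arctanIco.comp continuous_fst) hc
  refine ⟨hc, hinv.injective, he.isProperMap, he, he.isClosed_range, ?_, ?_⟩
  · ext p
    constructor
    · rintro ⟨⟨t, rfl⟩, ht⟩
      have ht : (t : ℝ) = 0 := ht
      simp [ht]
    · rintro rfl
      exact ⟨⟨⟨0, le_rfl, one_pos⟩, Prod.ext (by simp) rfl⟩, rfl⟩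
  · rintro _ ⟨t, rfl⟩
    exact t.2.2.ne
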